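/- A finite set R of rows of H admits a triangular enumeration if and only if every nonempty subset S of R contains a column whose weight within S is exactly 1. (This is the characterization of label-and-decide encodability underlying Theorems 1 and 2: the encoder succeeds precisely when no sub-collection of check nodes has all its support columns covered at least twice.) -/

import Mathlib

/-- A triangular enumeration of a finite set `R` of rows of `H`. -/
def TriangularEnum {M N : Type*} [DecidableEq M] (H : Matrix M N (ZMod 2))
    (R : Finset M) : Prop :=
  ∃ (e : Fin R.card → M) (c : Fin R.card → N),
    Function.Injective e ∧ (∀ k, e k ∈ R) ∧
    Function.Injective c ∧
    (∀ k, H (e k) (c k) = 1) ∧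
    (∀ k l, k < l → H (e k) (c l) = 0)

theorem triangular_aux {M N : Type*} [DecidableEq M] (H : Matrix M N (ZMod 2)) (n : ℕ) :
    ∀ R : Finset M, R.card = n →
      (∀ S : Finset M, S ⊆ R → S.Nonempty →
        ∃ j, (S.filter (fun i => H i j = 1)).card = 1) →
      ∃ (e : Fin n → M) (c : Fin n → N),
        Function.Injective e ∧ (∀ k, e k ∈ R) ∧
        (∀ k, H (e k) (c k) = 1) ∧
        (∀ k l, k < l → H (e k) (c l) = 0) := by
  induction n with
  | zero =>
    intro R _ _
    exact ⟨fun k => k.elim0, fun k => k.elim0, fun k => k.elim0, fun k => k.elim0,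
      fun k => k.elim0, fun k => k.elim0⟩
  | succ n ih =>
    intro R hR h
    obtain ⟨j, hj⟩ := h R (Finset.Subset.refl R) (Finset.card_pos.mp (by omega))
    obtain ⟨i, hi⟩ := Finset.card_eq_one.mp hj
    have hmem : ∀ x, (x ∈ R ∧ H x j = 1) ↔ x = i := by
      intro x
      rw [← Finset.mem_filter (p := fun x => H x j = 1), hi, Finset.mem_singleton]
    obtain ⟨hiR, hij⟩ := (hmem i).2 rfl
    obtain ⟨e, c, he, heR, h1, h0⟩ := ih (R.erase i)
      (by rw [Finset.card_erase_of_mem hiR]; omega)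
      (fun S hS => h S (hS.trans (Finset.erase_subset i R)))
    have hne : ∀ k, e k ≠ i := fun k => Finset.ne_of_mem_erase (heR k)
    have hR' : ∀ k, e k ∈ R := fun k => Finset.mem_of_mem_erase (heR k)
    have hz : ∀ z : ZMod 2, z ≠ 1 → z = 0 := by decide
    refine ⟨Fin.snoc (α := fun _ => M) e i, Fin.snoc (α := fun _ => N) c j, ?_, ?_, ?_, ?_⟩
    · intro a b
      refine Fin.lastCases ?_ (fun a => ?_) a <;> refine Fin.lastCases ?_ (fun b => ?_) b
      · simp
      · simpa using fun hh => absurd hh.symm (hne b)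
      · simpa using fun hh => absurd hh (hne a)
      · simpa using fun hh => he hh
    · intro a
      refine Fin.lastCases ?_ (fun a => ?_) a
      · simpa using hiR
      · simpa using hR' a
    · intro a
      refine Fin.lastCases ?_ (fun a => ?_) a
      · simpa using hij
      · simpa using h1 a
    · intro a b
      refine Fin.lastCases ?_ (fun a => ?_) a <;> refine Fin.lastCases ?_ (fun b => ?_) b
      · intro hh
        exact absurd hh (lt_irrefl _)
      · intro hh
        exact absurd hh (not_lt.mpr (Fin.le_last _))
      · intro _
        simpa using hz _ (fun hh => hne a ((hmem _).1 ⟨hR' a, hh⟩))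
      · intro hh
        simpa using h0 a b (by simpa using hh)

theorem triangularEnum_iff_every_subset_has_weight_one_column {M N : Type*} [Fintype M]
    [DecidableEq M] [Fintype N] (H : Matrix M N (ZMod 2)) (R : Finset M) :
    TriangularEnum H R ↔
      ∀ S : Finset M, S ⊆ R → S.Nonempty →
        ∃ j, (S.filter (fun i => H i j = 1)).card = 1 := by
  constructor
  · rintro ⟨e, c, he, heR, -, h1, h0⟩ S hS ⟨s, hs⟩
    have himg : Finset.univ.image e = R := by
      apply Finset.eq_of_subset_of_card_le
      · intro x hx
        obtain ⟨k, -, rfl⟩ := Finset.mem_image.mp hx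
        exact heR k
      · rw [Finset.card_image_of_injective _ he]
        simp
    have hsurj : ∀ x ∈ S, ∃ k, e k = x := by
      intro x hx
      have := hS hx
      rw [← himg] at this
      simpa using this
    obtain ⟨k₀, hk₀⟩ := hsurj s hs
    obtain ⟨k, hk, hmax⟩ := (Finset.univ.filter (fun k => e k ∈ S)).exists_max_image id
      ⟨k₀, by simp [hk₀, hs]⟩
    have hkS : e k ∈ S := by simpa using hk
    refine ⟨c k, Finset.card_eq_one.mpr ⟨e k, ?_⟩⟩
    ext x
    rw [Finset.mem_filter, Finset.mem_singleton]
    constructor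
    · rintro ⟨hx, hx1⟩
      obtain ⟨l, rfl⟩ := hsurj x hx
      have hle : l ≤ k := hmax l (by simpa using hx)
      rcases hle.lt_or_eq with hlt | rfl
      · rw [h0 l k hlt] at hx1
        exact absurd hx1 (by decide)
      · rfl
    · rintro rfl
      exact ⟨hkS, h1 k⟩
  · intro h
    obtain ⟨e, c, he, heR, h1, h0⟩ := triangular_aux H R.card R rfl h
    refine ⟨e, c, he, heR, ?_, h1, h0⟩
    have key : ∀ a b, a < b → c a ≠ c b := by
      intro a b hab hc
      have h2 := h0 a b hab
      rw [← hc, h1 a] at h2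
      exact absurd h2 (by decide)
    intro a b hc
    rcases lt_trichotomy a b with hab | hab | hab
    · exact absurd hc (key a b hab)
    · exact hab
    · exact absurd hc.symm (key b a hab)
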